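/- Consider a sequence of events where an agent b holds a multiset of at most 2 proposals, and at each step either a new proposal arrives and, if b then holds 3 proposals, b discards one that is 'least desirable' (not superior to any other held proposal), where 'superiority' is a property that, once a held proposal becomes good, it remains good forever, and any discarded-in-favor-of proposal is superior to the discarded one. If goodness of a proposal is monotone over time and a proposal that is rejected in favor of a non-good proposal must itself be non-good, then the number of good proposals held by b never decreases over time. -/

import Mathlib

theorem Multiset.countP_le_countP_erase_cons {P : Type*} [DecidableEq P]
    (good : P → Prop) [DecidablePred good] {m : Multiset P} {p q : P}
    (hq : q ∈ p ::ₘ m) (h : ¬ good p → ¬ good q) :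
    m.countP good ≤ ((p ::ₘ m).erase q).countP good := by
  have key := congrArg (Multiset.countP good) (Multiset.cons_erase hq)
  rw [Multiset.countP_cons, Multiset.countP_cons] at key
  split_ifs at key <;> first | omega | tauto


/-- Monotonicity of the number of good proposals held (abstract Lemma 3.5).
An agent holds a multiset `held t` of at most 2 proposals at each time `t`.  At each
step either nothing changes, or a new proposal `p` arrives and is kept, or a new
proposal `p` arrives and one proposal `q` among the three now present is discarded,
where `q` is a least desirable one; abstractly this means that if the proposal `p`
in whose favour `q` is rejected is not good, then `q` itself is not good.  If the
goodness of a proposal is monotone over time, then the number of good proposals held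
never decreases. -/
theorem stmt15 {P : Type*} [DecidableEq P]
    (held : ℕ → Multiset P) (good : ℕ → P → Prop)
    [∀ t, DecidablePred (good t)]
    (hcard : ∀ t, Multiset.card (held t) ≤ 2)
    (hmono : ∀ t p, good t p → good (t + 1) p)
    (hstep : ∀ t, held (t + 1) = held t ∨
      (∃ p : P, held (t + 1) = p ::ₘ held t) ∨
      (∃ p q : P, q ∈ p ::ₘ held t ∧ held (t + 1) = (p ::ₘ held t).erase q ∧
        (¬ good t p → ¬ good t q))) :
    ∀ s t : ℕ, s ≤ t →
      Multiset.card ((held s).filter (good s)) ≤ Multiset.card ((held t).filter (good t)) := by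
  simp only [← Multiset.countP_eq_card_filter]
  intro s t hst
  refine monotone_nat_of_le_succ (f := fun t => (held t).countP (good t)) (fun t => ?_) hst
  have hle : (held t).countP (good t) ≤ (held (t + 1)).countP (good t) := by
    rcases hstep t with h | ⟨p, h⟩ | ⟨p, q, hq, h, hpq⟩
    · rw [h]
    · rw [h]
      exact Multiset.countP_le_of_le _ (Multiset.le_cons_self _ _)
    · rw [h]
      exact Multiset.countP_le_countP_erase_cons _ hq hpq
  refine hle.trans ?_
  simp only [Multiset.countP_eq_card_filter]
  exact Multiset.card_le_card (Multiset.monotone_filter_right _ fun p => hmono t p)
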